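/- Let G be an amenable group with a Følner net F = (F_i)_{i∈I}, let X be an algebraic variety over an algebraically closed field K, let A := X(K), and let τ : A^G → A^G be an algebraic cellular automaton over (G,X,K). If τ is (**)-pre-injective, then mdim_F(τ(A^G)) = dim(X). -/

import Mathlib

open AlgebraicGeometry CategoryTheory CategoryTheory.Limits Filter Topology
open scoped ENNReal NNReal

noncomputable section

namespace GOE

/-! ## Følner nets and amenability -/

/-- A (right) Følner net for a group `G`: a net of nonempty finite subsets `F i ⊆ G`,
indexed by a directed nonempty preorder, such that `|F i \ F i g| / |F i| → 0` for every
`g ∈ G`. -/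
structure FolnerNet (G : Type) [Group G] where
  ι : Type
  [pre : Preorder ι]
  [ne : Nonempty ι]
  [dir : IsDirected ι (· ≤ ·)]
  F : ι → Finset G
  nonempty : ∀ i, (F i).Nonempty
  folner : ∀ g : G,
    Filter.Tendsto
      (fun i => ((((F i : Set G) \ ((· * g) '' (F i : Set G))).ncard : ℝ) / ((F i).card : ℝ)))
      Filter.atTop (nhds 0)

attribute [instance] FolnerNet.pre FolnerNet.ne FolnerNet.dir

/-- A group is amenable if it admits a Følner net. -/
def Amenable (G : Type) [Group G] : Prop := Nonempty (FolnerNet G)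

/-! ## Constructible subsets of a topological space -/

/-- A subset of a topological space is constructible if it is a finite union of
locally closed subsets. -/
def IsConstr {X : Type} [TopologicalSpace X] (C : Set X) : Prop :=
  ∃ (n : ℕ) (U Z : Fin n → Set X), (∀ i, IsOpen (U i)) ∧ (∀ i, IsClosed (Z i)) ∧
    C = ⋃ i, U i ∩ Z i

/-- Conversion of a Krull dimension (an element of `WithBot ℕ∞`) to an extended real. -/
def dimE (d : WithBot ℕ∞) : EReal :=
  WithBot.recBotCoe ⊥ (fun n : ℕ∞ => ((n : ℝ≥0∞) : EReal)) d

/-! ## Varieties over a field and their points -/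

variable (K : Type) [Field K]

/-- The spectrum of the field `K`, as a scheme. -/
abbrev SpecK : Scheme := Spec (CommRingCat.of K)

/-- The unique point of `Spec K`. -/
def specPt : SpecK K := (⟨⊥, Ideal.bot_prime⟩ : PrimeSpectrum K)

instance : HasFiniteProducts (Over (SpecK K)) :=
  CategoryTheory.Over.ConstructProducts.over_finiteProducts_of_finiteWidePullbacks

/-- The set of `K`-points of a `K`-scheme, i.e. sections of the structure morphism,
i.e. morphisms `Spec K ⟶ X` over `Spec K`. -/
abbrev Pt (W : Over (SpecK K)) : Type := Over.mk (𝟙 (SpecK K)) ⟶ W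

/-- The image in (the underlying space of) `W` of a `K`-point of `W`. -/
def ev {W : Over (SpecK K)} (a : Pt K W) : W.left := a.left.base (specPt K)

/-- The fibered power `X^Ω` over `Spec K` of a `K`-scheme `X`, for a finite index set `Ω`. -/
def pow (V : Over (SpecK K)) (Ω : Type) [Finite Ω] : Over (SpecK K) :=
  ∏ᶜ (fun _ : Ω => V)

/-- The canonical identification of families of `K`-points indexed by `Ω` with
`K`-points of the fibered power `X^Ω`. -/
def ptPow (V : Over (SpecK K)) (Ω : Type) [Finite Ω] (a : Ω → Pt K V) :
    Pt K (pow K V Ω) := Pi.lift a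

variable (V : Over (SpecK K))

/-- The Krull dimension of (the underlying space of) a `K`-scheme. -/
def vdim : WithBot ℕ∞ := topologicalKrullDim V.left

/-- The Zariski topology on `A^Ω` (`A` the set of `K`-points of `X`), induced from the
Zariski topology of the fibered power `X^Ω` via the identification of `A^Ω` with a
subset (the set of closed points, for `K` algebraically closed) of `X^Ω`. -/
def cfgTop (Ω : Type) [Finite Ω] : TopologicalSpace (Ω → Pt K V) :=
  TopologicalSpace.induced (fun u => ev K (ptPow K V Ω u)) inferInstance

/-- The Krull dimension of a subset `D ⊆ A^Ω` for the Zariski topology. -/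
def cfgDim (Ω : Type) [Finite Ω] (D : Set (Ω → Pt K V)) : WithBot ℕ∞ :=
  letI := cfgTop K V Ω
  topologicalKrullDim D

/-- `D ⊆ A^Ω` is closed for the Zariski topology. -/
def cfgClosed (Ω : Type) [Finite Ω] (D : Set (Ω → Pt K V)) : Prop :=
  letI := cfgTop K V Ω
  IsClosed D

/-- `D ⊆ A^Ω` is constructible for the Zariski topology. -/
def cfgConstr (Ω : Type) [Finite Ω] (D : Set (Ω → Pt K V)) : Prop :=
  letI := cfgTop K V Ω
  IsConstr D

/-! ## Configurations, restrictions, cylinders -/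

variable {G : Type} [Group G]

/-- The restriction `Γ_Ω ⊆ A^Ω` of a set of configurations `Γ ⊆ A^G`. -/
def restr (Γ : Set (G → Pt K V)) (Ω : Finset G) : Set (↥Ω → Pt K V) :=
  (fun c (ω : ↥Ω) => c ω) '' Γ

/-- The cylinder `D_p ⊆ A^G`: configurations restricting to an element of `D` on `Ω` and
to `p` on `G ∖ Ω`. -/
def cyl (Ω : Finset G) (D : Set (↥Ω → Pt K V)) (p : {g : G // g ∉ Ω} → Pt K V) :
    Set (G → Pt K V) :=
  {c | (fun ω : ↥Ω => c ω) ∈ D ∧ ∀ (g : G) (h : g ∉ Ω), c g = p ⟨g, h⟩}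

/-- Algebraic mean dimension of `Γ ⊆ A^G` with respect to a Følner net. -/
def mdim (𝓕 : FolnerNet G) (Γ : Set (G → Pt K V)) : EReal :=
  Filter.limsup
    (fun i => dimE (cfgDim K V ↥(𝓕.F i) (restr K V Γ (𝓕.F i))) *
      ((((𝓕.F i).card : ℝ)⁻¹ : ℝ) : EReal))
    Filter.atTop

/-! ## Cellular automata -/

/-- `τ : A^G → A^G` is an algebraic cellular automaton over `(G, X, K)`: it admits a finite
memory set `M ⊆ G` whose associated local defining map `A^M → A` is induced by a morphism
of `K`-schemes `f : X^M → X`. -/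
def IsAlgCA (τ : (G → Pt K V) → (G → Pt K V)) : Prop :=
  ∃ (M : Finset G) (f : pow K V ↥M ⟶ V),
    ∀ (x : G → Pt K V) (g : G),
      τ x g = ptPow K V ↥M (fun m => x (g * (m : G))) ≫ f

/-- Pre-injectivity: configurations that are almost equal and have the same image are equal. -/
def PreInjective (τ : (G → Pt K V) → (G → Pt K V)) : Prop :=
  ∀ c₁ c₂ : G → Pt K V, {g : G | c₁ g ≠ c₂ g}.Finite → τ c₁ = τ c₂ → c₁ = c₂

/-- `(*)`-pre-injectivity: there exist no finite subset `Ω ⊆ G` and Zariski-closed proper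
subset `H ⊊ A^Ω` such that `τ((A^Ω)_p) = τ(H_p)` for all `p ∈ A^{G∖Ω}`. -/
def StarPreInjective (τ : (G → Pt K V) → (G → Pt K V)) : Prop :=
  ¬ ∃ (Ω : Finset G) (H : Set (↥Ω → Pt K V)), cfgClosed K V ↥Ω H ∧ H ≠ Set.univ ∧
      ∀ p : {g : G // g ∉ Ω} → Pt K V,
        τ '' cyl K V Ω Set.univ p = τ '' cyl K V Ω H p

/-- `(**)`-pre-injectivity: there is no finite subset `Ω ⊆ G` such that, for every
`p ∈ A^{G∖Ω}`, the finite-support set `τ((A^Ω)_p)` (written as some `R_s`) satisfies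
`dim(R) < dim(A^Ω)`. -/
def StarStarPreInjective (τ : (G → Pt K V) → (G → Pt K V)) : Prop :=
  ¬ ∃ Ω : Finset G, ∀ p : {g : G // g ∉ Ω} → Pt K V,
      ∃ (Λ : Finset G) (R : Set (↥Λ → Pt K V)) (s : {g : G // g ∉ Λ} → Pt K V),
        τ '' cyl K V Ω Set.univ p = cyl K V Λ R s ∧
        cfgDim K V ↥Λ R < cfgDim K V ↥Ω (Set.univ : Set (↥Ω → Pt K V))

/-- `Γ ⊆ A^G` is closed for the prodiscrete topology on `A^G`. -/
def ProdiscreteClosed {A : Type} (Γ : Set (G → A)) : Prop :=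
  letI : TopologicalSpace A := ⊥
  IsClosed Γ

/-- `Γ ⊆ A^G` is invariant under the shift action of `G`. -/
def ShiftInvariant {A : Type} (Γ : Set (G → A)) : Prop :=
  ∀ (g : G), ∀ c ∈ Γ, (fun h : G => c (g⁻¹ * h)) ∈ Γ

/-- An `(E,E')`-tiling of `G`. -/
def IsTiling (E E' : Finset G) (T : Set G) : Prop :=
  (∀ g ∈ T, ∀ h ∈ T, g ≠ h →
    Disjoint ((g * ·) '' (E : Set G)) ((h * ·) '' (E : Set G))) ∧
  ∀ x : G, ∃ g ∈ T, x ∈ (g * ·) '' (E' : Set G)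


open Cardinal in
/-- The transcendence degree drops strictly along a strict specialization in an algebra of
finite type. -/
theorem trdeg_quotient_lt_of_lt {k A : Type} [Field k] [CommRing A] [Algebra k A]
    [Algebra.FiniteType k A] {p q : Ideal A} [p.IsPrime] [q.IsPrime] (h : p < q) :
    Algebra.trdeg k (A ⧸ q) < Algebra.trdeg k (A ⧸ p) := by
  have hle : Algebra.trdeg k (A ⧸ q) ≤ Algebra.trdeg k (A ⧸ p) :=
    trdeg_le_of_surjective (Ideal.Quotient.factorₐ k h.le)
      (Ideal.Quotient.factor_surjective h.le)
  refine lt_of_le_of_ne hle fun heq => ?_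
  obtain ⟨ι, x, hx⟩ := exists_isTranscendenceBasis' k (A ⧸ q)
  obtain ⟨y, hy⟩ : ∃ y : ι → A ⧸ p, Ideal.Quotient.factorₐ k h.le ∘ y = x :=
    ⟨fun i => (Ideal.Quotient.factor_surjective h.le (x i)).choose,
      funext fun i => (Ideal.Quotient.factor_surjective h.le (x i)).choose_spec⟩
  have hyi : AlgebraicIndependent k y := by
    refine AlgebraicIndependent.of_comp (Ideal.Quotient.factorₐ k h.le) ?_
    rw [hy]; exact hx.1
  have hyb : IsTranscendenceBasis k y := by
    refine hyi.isTranscendenceBasis_of_trdeg_le trdeg_lt_aleph0_of_finiteType ?_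
    rw [← heq, hx.cardinalMk_eq_trdeg]
  obtain ⟨a, haq, hap⟩ := Set.exists_of_ssubset h
  have hyalg := hyb.isAlgebraic
  have hane : (Ideal.Quotient.mk p a) ≠ 0 := fun h0 => hap (Ideal.Quotient.eq_zero_iff_mem.mp h0)
  obtain ⟨r, hr, c, hc⟩ := (hyalg.isAlgebraic (Ideal.Quotient.mk p a)).exists_nonzero_dvd
    (mem_nonZeroDivisors_of_ne_zero hane)
  obtain ⟨P, hP⟩ : ∃ P : MvPolynomial ι k, MvPolynomial.aeval y P = (r : A ⧸ p) := by
    have hr2 : (r : A ⧸ p) ∈ Algebra.adjoin k (Set.range y) := r.2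
    exact (Algebra.adjoin_range_eq_range_aeval k y).le hr2
  have h0 : MvPolynomial.aeval x P = 0 := by
    have h1 : MvPolynomial.aeval x P
        = Ideal.Quotient.factorₐ k h.le (MvPolynomial.aeval y P) := by
      rw [← hy]; exact (MvPolynomial.comp_aeval_apply (f := y) _ P).symm
    rw [h1, hP]
    have h2 : (r : A ⧸ p) = Ideal.Quotient.mk p a * c := hc
    rw [h2, map_mul]
    have h3 : Ideal.Quotient.factorₐ k h.le (Ideal.Quotient.mk p a) = 0 :=
      Ideal.Quotient.eq_zero_iff_mem.mpr haq
    rw [h3, zero_mul]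
  have hP0 : P = 0 := (algebraicIndependent_iff.mp hx.1) P h0
  apply hr
  ext
  rw [← hP, hP0, map_zero]; rfl

/-- The Krull dimension of a nonzero algebra of finite type is at least its transcendence degree. -/
theorem le_ringKrullDim_of_le_trdeg {k R : Type} [Field k] [CommRing R] [IsDomain R] [Algebra k R]
    [Algebra.FiniteType k R] {n : ℕ} (hn : (n : Cardinal) ≤ Algebra.trdeg k R) :
    (n : WithBot ℕ∞) ≤ ringKrullDim R := by
  obtain ⟨s, g, hg, hi⟩ := exists_integral_inj_algHom_of_fg k R
  let := g.toRingHom.toAlgebra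
  have : IsScalarTower k (MvPolynomial (Fin s) k) R :=
    IsScalarTower.of_algebraMap_eq' g.comp_algebraMap.symm
  have : Algebra.IsIntegral (MvPolynomial (Fin s) k) R := ⟨hi⟩
  have : FaithfulSMul (MvPolynomial (Fin s) k) R :=
    (faithfulSMul_iff_algebraMap_injective _ _).mpr hg
  have htr : Algebra.trdeg k R = s := by
    rw [← trdeg_add_eq k (MvPolynomial (Fin s) k) (A := R),
      trdeg_eq_zero (R := MvPolynomial (Fin s) k) (A := R),
      MvPolynomial.trdeg_of_isDomain]
    simp
  have hns : n ≤ s := by rw [htr] at hn; exact_mod_cast hn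
  have h1 : ringKrullDim (MvPolynomial (Fin s) k) = s := by
    rw [MvPolynomial.ringKrullDim_of_isNoetherianRing, ringKrullDim_eq_zero_of_field]
    simp
  obtain ⟨l, hl⟩ := (Order.le_krullDim_iff (α := PrimeSpectrum (MvPolynomial (Fin s) k))
    (n := s)).mp h1.ge
  obtain ⟨P, hP, hP'⟩ := Ideal.exists_ideal_over_prime_of_isIntegral l.head.asIdeal (⊥ : Ideal R)
    (by
      rw [← RingHom.ker_eq_comap_bot,
        (RingHom.injective_iff_ker_eq_bot (algebraMap (MvPolynomial (Fin s) k) R)).mp hg]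
      exact bot_le)
  have : P.IsPrime := hP'.1
  have : P.LiesOver l.head.asIdeal := ⟨hP'.2.symm⟩
  obtain ⟨L, hL, -⟩ := Ideal.exists_ltSeries_of_hasGoingUp l P
  refine le_trans (by exact_mod_cast hns) (?_ : (s : WithBot ℕ∞) ≤ _)
  exact Order.le_krullDim_iff.mpr ⟨L, hL.trans hl⟩

/-- Every point of an affine scheme lying generically on the closure of an image point
is itself in the image. -/
theorem exists_notMem_forall_comap_eq {A B : Type} [CommRing A] [CommRing B] {g : A →+* B}
    (hg : g.FinitePresentation) (q : PrimeSpectrum B) :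
    ∃ f : A, f ∉ (q.comap g).asIdeal ∧ ∀ p' : PrimeSpectrum A,
      (q.comap g).asIdeal ≤ p'.asIdeal → f ∉ p'.asIdeal → ∃ q' : PrimeSpectrum B,
        q'.comap g = p' := by
  obtain ⟨S, hS⟩ := PrimeSpectrum.exists_constructibleSetData_iff.mpr
    (PrimeSpectrum.isConstructible_range_comap hg)
  have hq : q.comap g ∈ S.toSet := by rw [hS]; exact ⟨q, rfl⟩
  obtain ⟨C, hC, hCq⟩ := Set.mem_iUnion₂.mp hq
  refine ⟨C.f, fun h => hCq.2 (by simpa using h), fun p' hp hf => ?_⟩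
  have : p' ∈ S.toSet := by
    refine Set.mem_iUnion₂.mpr ⟨C, hC, ?_, by simpa using hf⟩
    exact fun a ha => hp (hCq.1 ha)
  rw [hS] at this
  exact this

theorem exists_inducing_comap_maximal {k A B : Type} [Field k] [CommRing A] [CommRing B]
    [Algebra k A] [Algebra k B] [Algebra.FiniteType k A] [Algebra.FiniteType k B]
    (g : A →ₐ[k] B) (q : PrimeSpectrum B) :
    ∃ (R : Type) (_ : CommRing R) (_ : IsDomain R) (_ : Algebra k R) (_ : Algebra.FiniteType k R)
      (r : A →ₐ[k] R), IsInducing (PrimeSpectrum.comap (r : A →+* R)) ∧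
      Algebra.trdeg k (A ⧸ (q.comap (g : A →+* B)).asIdeal) ≤ Algebra.trdeg k R ∧
      ∀ M : PrimeSpectrum R, ∃ Q : PrimeSpectrum B,
        Q.comap (g : A →+* B) = M.comap (r : A →+* R) := by
  have : IsNoetherianRing A := Algebra.FiniteType.isNoetherianRing k A
  have hfp : (g : A →+* B).FinitePresentation := by
    let := (g : A →+* B).toAlgebra
    have : IsScalarTower k A B := IsScalarTower.of_algebraMap_eq' g.comp_algebraMap.symm
    have : Algebra.FiniteType A B := Algebra.FiniteType.of_restrictScalars_finiteType k A B
    exact RingHom.FinitePresentation.of_finiteType.mp this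
  obtain ⟨f, hf, H⟩ := exists_notMem_forall_comap_eq hfp q
  set p := (q.comap (g : A →+* B)).asIdeal with hp
  have hfne : Ideal.Quotient.mk p f ≠ 0 := fun h0 => hf (Ideal.Quotient.eq_zero_iff_mem.mp h0)
  let R := Localization.Away (Ideal.Quotient.mk p f)
  have hle : Submonoid.powers (Ideal.Quotient.mk p f) ≤ nonZeroDivisors (A ⧸ p) :=
    powers_le_nonZeroDivisors_of_noZeroDivisors hfne
  have : IsDomain R := IsLocalization.isDomain_localization hle
  have : Algebra.FiniteType (A ⧸ p) R :=
    IsLocalization.finiteType_of_monoid_fg (Submonoid.powers (Ideal.Quotient.mk p f)) R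
  have : Algebra.FiniteType k R := Algebra.FiniteType.trans (S := A ⧸ p) inferInstance inferInstance
  refine ⟨R, inferInstance, inferInstance, inferInstance, inferInstance,
    (IsScalarTower.toAlgHom k (A ⧸ p) R).comp (Ideal.Quotient.mkₐ k p), ?_, ?_, ?_⟩
  · have h1 := (PrimeSpectrum.localization_away_isOpenEmbedding R
      (Ideal.Quotient.mk p f)).isInducing
    have h2 := (PrimeSpectrum.isClosedEmbedding_comap_of_surjective (A ⧸ p) (Ideal.Quotient.mk p)
      Ideal.Quotient.mk_surjective).isInducing
    exact h2.comp h1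
  · exact trdeg_le_of_injective (IsScalarTower.toAlgHom k (A ⧸ p) R)
      (IsLocalization.injective R hle)
  · intro M
    refine H _ ?_ ?_
    · intro a ha
      change algebraMap (A ⧸ p) R (Ideal.Quotient.mk p a) ∈ M.asIdeal
      rw [Ideal.Quotient.eq_zero_iff_mem.mpr ha, map_zero]
      exact zero_mem _
    · intro hM
      change algebraMap (A ⧸ p) R (Ideal.Quotient.mk p f) ∈ M.asIdeal at hM
      exact M.isPrime.ne_top (Ideal.eq_top_of_isUnit_mem _ hM
        (IsLocalization.Away.algebraMap_isUnit _))

/-- The spectrum of a `K`-algebra, as a scheme over `K`. -/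
def specOver (K : Type) [Field K] (R : Type) [CommRing R] [Algebra K R] : Over (SpecK K) :=
  Over.mk (Spec.map (CommRingCat.ofHom (algebraMap K R)))

/-- The morphism of `K`-schemes induced by a homomorphism of `K`-algebras. -/
def specOverMap {K R S : Type} [Field K] [CommRing R] [CommRing S] [Algebra K R] [Algebra K S]
    (φ : R →ₐ[K] S) : specOver K S ⟶ specOver K R :=
  Over.homMk (Spec.map (CommRingCat.ofHom (φ : R →+* S))) (by
    change Spec.map _ ≫ Spec.map _ = Spec.map _
    rw [← Spec.map_comp, ← CommRingCat.ofHom_comp, φ.comp_algebraMap])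

theorem specOverMap_comp {K R S T : Type} [Field K] [CommRing R] [CommRing S] [CommRing T]
    [Algebra K R] [Algebra K S] [Algebra K T] (φ : R →ₐ[K] S) (ψ : S →ₐ[K] T) :
    specOverMap (ψ.comp φ) = specOverMap ψ ≫ specOverMap φ := by
  ext1
  exact Spec.map_comp (CommRingCat.ofHom (φ : R →+* S)) (CommRingCat.ofHom (ψ : S →+* T))

theorem specOverMap_surjective {K R S : Type} [Field K] [CommRing R] [CommRing S] [Algebra K R]
    [Algebra K S] (s : specOver K S ⟶ specOver K R) : ∃ φ : R →ₐ[K] S, s = specOverMap φ := by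
  obtain ⟨ψ, hψ⟩ := Spec.map_surjective s.left
  have hw : Spec.map ψ ≫ Spec.map (CommRingCat.ofHom (algebraMap K R)) =
      Spec.map (CommRingCat.ofHom (algebraMap K S)) := by rw [hψ]; exact Over.w s
  rw [← Spec.map_comp] at hw
  have hw' := congrArg CommRingCat.Hom.hom (Spec.map_injective hw)
  refine ⟨{ ψ.hom with commutes' := fun r => congrArg (fun f : K →+* S => f r) hw' }, ?_⟩
  ext1
  exact hψ.symm

/-- The point of the spectrum of a field. -/
def fieldPt (K : Type) [Field K] (L : Type) [Field L] [Algebra K L] : (specOver K L).left :=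
  (⊥ : PrimeSpectrum L)

/-- The prime ideal corresponding to a point of an affine scheme. -/
def ptIdeal {K : Type} [Field K] {R : Type} [CommRing R] [Algebra K R] (p : (specOver K R).left) :
    Ideal R :=
  PrimeSpectrum.asIdeal (R := R) p

instance {K : Type} [Field K] {R : Type} [CommRing R] [Algebra K R] (p : (specOver K R).left) :
    (ptIdeal p).IsPrime :=
  PrimeSpectrum.isPrime (R := R) p

theorem eq_fieldPt {K L : Type} [Field K] [Field L] [Algebra K L] (z : (specOver K L).left) :
    z = fieldPt K L :=
  Subsingleton.elim (α := PrimeSpectrum L) _ _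

theorem comp_left_apply {K : Type} [Field K] {W W' W'' : Over (SpecK K)} (f : W ⟶ W')
    (g : W' ⟶ W'') (x : W.left) : (f ≫ g).left x = g.left (f.left x) := rfl

/-- The residue field of a point of a `K`-scheme. -/
def ResField (K : Type) [Field K] (W : Over (SpecK K)) (x : W.left) : Type := W.left.residueField x

instance (K : Type) [Field K] (W : Over (SpecK K)) (x : W.left) : Field (ResField K W x) :=
  inferInstanceAs (Field (W.left.residueField x))

instance (K : Type) [Field K] (W : Over (SpecK K)) (x : W.left) : Algebra K (ResField K W x) :=
  (Spec.preimage (S := W.left.residueField x) (W.left.fromSpecResidueField x ≫ W.hom)).hom.toAlgebra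

/-- The canonical morphism from the spectrum of the residue field of a point. -/
def fromRes {K : Type} [Field K] (W : Over (SpecK K)) (x : W.left) :
    specOver K (ResField K W x) ⟶ W :=
  Over.homMk (W.left.fromSpecResidueField x) (by exact (Spec.map_preimage _).symm)

theorem fromRes_apply {K : Type} [Field K] (W : Over (SpecK K)) (x : W.left)
    (s : (specOver K (ResField K W x)).left) : (fromRes W x).left s = x :=
  W.left.fromSpecResidueField_apply x s

theorem exists_eq_specOverMap_fromRes {K L : Type} [Field K] [Field L] [Algebra K L]
    {W : Over (SpecK K)} (s : specOver K L ⟶ W) (z : (specOver K L).left) :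
    ∃ φ : ResField K W (s.left z) →ₐ[K] L, s = specOverMap φ ≫ fromRes W (s.left z) := by
  obtain rfl := eq_fieldPt z
  obtain ⟨⟨x, ψ⟩, h⟩ := (Scheme.SpecToEquivOfField L W.left).symm.surjective s.left
  change Spec.map ψ ≫ W.left.fromSpecResidueField x = s.left at h
  have hx : s.left (fieldPt K L) = x := by
    rw [← h]; exact W.left.fromSpecResidueField_apply x _
  rw [hx]
  let t : specOver K L ⟶ specOver K (ResField K W x) := Over.homMk (Spec.map ψ) (by
    have h1 : (specOver K (ResField K W x)).hom = W.left.fromSpecResidueField x ≫ W.hom :=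
      (Over.w (fromRes W x)).symm
    rw [h1]
    exact ((Category.assoc _ _ _).symm.trans (congrArg (· ≫ W.hom) h)).trans (Over.w s))
  obtain ⟨φ, hφ⟩ := specOverMap_surjective t
  refine ⟨φ, ?_⟩
  rw [← hφ]
  ext1
  exact h.symm

/-- The transcendence degree of the residue field of a point. -/
def ptdeg {K : Type} [Field K] {W : Over (SpecK K)} (x : W.left) : Cardinal :=
  Algebra.trdeg K (ResField K W x)

theorem ptdeg_le_trdeg {K L : Type} [Field K] [Field L] [Algebra K L]
    {W : Over (SpecK K)} (s : specOver K L ⟶ W) (z : (specOver K L).left) :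
    ptdeg (s.left z) ≤ Algebra.trdeg K L := by
  obtain ⟨φ, -⟩ := exists_eq_specOverMap_fromRes s z
  exact trdeg_le_of_injective φ φ.injective

theorem ptdeg_map_le {K : Type} [Field K] {W W' : Over (SpecK K)} (h : W ⟶ W') (x : W.left) :
    ptdeg (h.left x) ≤ ptdeg x := by
  have := ptdeg_le_trdeg (fromRes W x ≫ h) (fieldPt K (ResField K W x))
  rwa [comp_left_apply, fromRes_apply] at this

theorem ptdeg_map_of_isOpenImmersion {K : Type} [Field K] {W W' : Over (SpecK K)} (h : W ⟶ W')
    [IsOpenImmersion h.left] (x : W.left) : ptdeg (h.left x) = ptdeg x := by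
  refine (ptdeg_map_le h x).antisymm ?_
  have hr : Set.range (fromRes W' (h.left x)).left ⊆ Set.range h.left := by
    rintro _ ⟨z, rfl⟩
    rw [fromRes_apply]
    exact ⟨x, rfl⟩
  let s : specOver K (ResField K W' (h.left x)) ⟶ W :=
    Over.homMk (IsOpenImmersion.lift h.left (fromRes W' (h.left x)).left hr) (by
      rw [← Over.w h, IsOpenImmersion.lift_fac_assoc, Over.w])
  have hs : s ≫ h = fromRes W' (h.left x) := by
    ext1; exact IsOpenImmersion.lift_fac _ _ _
  have hx : s.left (fieldPt K (ResField K W' (h.left x))) = x := by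
    apply h.left.isOpenEmbedding.injective
    rw [← comp_left_apply, hs, fromRes_apply]
  have := ptdeg_le_trdeg s (fieldPt K (ResField K W' (h.left x)))
  rwa [hx] at this

theorem isAlgebraic_fractionRing (R : Type) [CommRing R] [IsDomain R] :
    Algebra.IsAlgebraic R (FractionRing R) :=
  (IsFractionRing.comap_isAlgebraic_iff (A := R) (K := FractionRing R)
    (C := FractionRing R)).mpr inferInstance

theorem ptdeg_specOver {K R : Type} [Field K] [CommRing R] [Algebra K R] (p : (specOver K R).left) :
    ptdeg p = Algebra.trdeg K (R ⧸ ptIdeal p) := by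
  apply le_antisymm
  · let L := FractionRing (R ⧸ (ptIdeal p))
    have := isAlgebraic_fractionRing (R ⧸ (ptIdeal p))
    let φ : R →ₐ[K] L :=
      (IsScalarTower.toAlgHom K (R ⧸ (ptIdeal p)) L).comp (Ideal.Quotient.mkₐ K _)
    have h1 := ptdeg_le_trdeg (specOverMap φ) (fieldPt K L)
    have h2 : (specOverMap φ).left (fieldPt K L) = p := by
      apply PrimeSpectrum.ext
      ext a
      change φ a ∈ (⊥ : Ideal L) ↔ _
      rw [Ideal.mem_bot, ← Ideal.Quotient.eq_zero_iff_mem]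
      exact (IsFractionRing.injective (R ⧸ (ptIdeal p)) L).eq_iff' (map_zero _)
    rw [h2] at h1
    refine h1.trans_eq ?_
    rw [← trdeg_add_eq K (R ⧸ (ptIdeal p)) (A := L), trdeg_eq_zero (R := R ⧸ (ptIdeal p)) (A := L),
      add_zero]
  · obtain ⟨φ, hφ⟩ := specOverMap_surjective (fromRes (specOver K R) p)
    have hk : ∀ a, φ a = 0 ↔ a ∈ (ptIdeal p) := by
      have := fromRes_apply (specOver K R) p (fieldPt K (ResField K (specOver K R) p))
      rw [hφ] at this
      intro a
      change φ a ∈ (⊥ : Ideal _) ↔ _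
      have h2 := congrArg (fun x : PrimeSpectrum R => a ∈ x.asIdeal) this
      exact h2.to_iff
    refine trdeg_le_of_injective (Ideal.Quotient.liftₐ (ptIdeal p) φ fun a ha => (hk a).mpr ha) ?_
    refine (injective_iff_map_eq_zero _).mpr fun a ha => ?_
    obtain ⟨a, rfl⟩ := Ideal.Quotient.mk_surjective a
    exact Ideal.Quotient.eq_zero_iff_mem.mpr ((hk a).mp ha)

theorem exists_chart {K : Type} [Field K] {W : Over (SpecK K)} (hW : LocallyOfFiniteType W.hom)
    {O : Set W.left} (hO : IsOpen O) {x : W.left} (hx : x ∈ O) :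
    ∃ (A : Type) (_ : CommRing A) (_ : Algebra K A) (_ : Algebra.FiniteType K A)
      (j : specOver K A ⟶ W), IsOpenImmersion j.left ∧ x ∈ Set.range j.left ∧
      Set.range j.left ⊆ O := by
  obtain ⟨U, hU, hxU, hUO⟩ := exists_isAffineOpen_mem_and_subset (U := ⟨O, hO⟩) hx
  let f : CommRingCat.of K ⟶ Γ(W.left, U) := Spec.preimage (hU.fromSpec ≫ W.hom)
  have hf : Spec.map f = hU.fromSpec ≫ W.hom := Spec.map_preimage _
  let : Algebra K Γ(W.left, U) := f.hom.toAlgebra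
  have hft : Algebra.FiniteType K Γ(W.left, U) := by
    have : LocallyOfFiniteType (Spec.map f) := by
      rw [hf]; infer_instance
    exact (HasRingHomProperty.Spec_iff (P := @LocallyOfFiniteType)).mp this
  refine ⟨Γ(W.left, U), inferInstance, inferInstance, hft,
    Over.homMk hU.fromSpec hf.symm, ?_, ?_, ?_⟩
  · exact hU.isOpenImmersion_fromSpec
  · exact hU.range_fromSpec.ge hxU
  · exact hU.range_fromSpec.le.trans hUO

theorem exists_chart_hom {K : Type} [Field K] {Y W : Over (SpecK K)}
    (hY : LocallyOfFiniteType Y.hom) (hW : LocallyOfFiniteType W.hom) (φ : Y ⟶ W) (y : Y.left) :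
    ∃ (A B : Type) (_ : CommRing A) (_ : CommRing B) (_ : Algebra K A) (_ : Algebra K B)
      (_ : Algebra.FiniteType K A) (_ : Algebra.FiniteType K B)
      (j : specOver K A ⟶ W) (i : specOver K B ⟶ Y) (g : A →ₐ[K] B),
      IsOpenImmersion j.left ∧ y ∈ Set.range i.left ∧ i ≫ φ = specOverMap g ≫ j := by
  obtain ⟨A, _, _, hA, j, hj, hyj, -⟩ := exists_chart hW isOpen_univ (x := φ.left y) trivial
  obtain ⟨B, _, _, hB, i, hi, hyi, hij⟩ := exists_chart hY
    (hj.base_open.isOpen_range.preimage φ.left.continuous) (x := y) hyj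
  have hr : Set.range (i ≫ φ).left ⊆ Set.range j.left := by
    rintro _ ⟨z, rfl⟩
    exact hij ⟨z, rfl⟩
  let s : specOver K B ⟶ specOver K A :=
    Over.homMk (IsOpenImmersion.lift j.left (i ≫ φ).left hr) (by
      rw [← Over.w j, IsOpenImmersion.lift_fac_assoc, Over.w])
  obtain ⟨g, hg⟩ := specOverMap_surjective s
  refine ⟨A, B, _, _, _, _, hA, hB, j, i, g, hj, hyi, ?_⟩
  rw [← hg]
  ext1
  exact (IsOpenImmersion.lift_fac _ _ _).symm

theorem ptdeg_lt_aleph0 {K : Type} [Field K] {W : Over (SpecK K)}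
    (hW : LocallyOfFiniteType W.hom) (x : W.left) : ptdeg x < Cardinal.aleph0 := by
  obtain ⟨A, _, _, hA, j, hj, ⟨p, rfl⟩, -⟩ := exists_chart hW isOpen_univ (x := x) trivial
  rw [ptdeg_map_of_isOpenImmersion, ptdeg_specOver]
  exact trdeg_lt_aleph0_of_finiteType

theorem ptdeg_lt_of_specializes {K : Type} [Field K] {W : Over (SpecK K)}
    (hW : LocallyOfFiniteType W.hom) {x y : W.left} (h : x ⤳ y) (hne : x ≠ y) :
    ptdeg y < ptdeg x := by
  obtain ⟨A, _, _, hA, j, hj, ⟨q, rfl⟩, -⟩ := exists_chart hW isOpen_univ (x := y) trivial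
  obtain ⟨p, hp⟩ : x ∈ Set.range j.left := h.mem_open hj.base_open.isOpen_range ⟨q, rfl⟩
  change j.left p = x at hp
  subst hp
  rw [ptdeg_map_of_isOpenImmersion, ptdeg_map_of_isOpenImmersion, ptdeg_specOver, ptdeg_specOver]
  have h1 : p ⤳ q := hj.base_open.isInducing.specializes_iff.mp h
  have h2 := (PrimeSpectrum.le_iff_specializes (R := A) p q).mpr h1
  exact trdeg_quotient_lt_of_lt (lt_of_le_of_ne h2 fun h3 => hne (congrArg _
    (PrimeSpectrum.ext (R := A) h3)))

theorem ptdeg_le_of_specializes {K : Type} [Field K] {W : Over (SpecK K)}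
    (hW : LocallyOfFiniteType W.hom) {x y : W.left} (h : x ⤳ y) : ptdeg y ≤ ptdeg x := by
  by_cases hne : x = y
  · rw [hne]
  · exact (ptdeg_lt_of_specializes hW h hne).le

theorem noetherianSpace_of_finiteType {K : Type} [Field K] {W : Over (SpecK K)}
    (hW : LocallyOfFiniteType W.hom) (hW' : QuasiCompact W.hom) :
    TopologicalSpace.NoetherianSpace W.left := by
  have : IsLocallyNoetherian (SpecK K) := inferInstance
  have := LocallyOfFiniteType.isLocallyNoetherian W.hom
  have : CompactSpace (SpecK K) := inferInstance
  have : CompactSpace W.left := QuasiCompact.compactSpace_of_compactSpace W.hom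
  have : IsNoetherian W.left := {}
  infer_instance

theorem exists_finite_forall_specializes (X : Type) [TopologicalSpace X]
    [TopologicalSpace.NoetherianSpace X] [QuasiSober X] :
    ∃ S : Set X, S.Finite ∧ ∀ x, ∃ s ∈ S, s ⤳ x := by
  choose f hf using fun C : irreducibleComponents X =>
    QuasiSober.sober (C.2.1 : IsIrreducible (C : Set X))
      (isClosed_of_mem_irreducibleComponents _ C.2)
  have := (TopologicalSpace.NoetherianSpace.finite_irreducibleComponents (α := X)).to_subtype
  refine ⟨Set.range f, Set.finite_range f, fun x => ?_⟩
  refine ⟨_, ⟨⟨irreducibleComponent x, irreducibleComponent_mem_irreducibleComponents x⟩, rfl⟩, ?_⟩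
  exact (hf _).specializes mem_irreducibleComponent

theorem closure_range_subset {X Y : Type} [TopologicalSpace X] [TopologicalSpace Y]
    [TopologicalSpace.NoetherianSpace X] [QuasiSober X] {f : X → Y} (hf : Continuous f) {y : Y}
    (hy : y ∈ closure (Set.range f)) : ∃ x, f x ⤳ y := by
  obtain ⟨S, hS, hSx⟩ := exists_finite_forall_specializes X
  have : closure (Set.range f) ⊆ ⋃ s ∈ S, closure {f s} := by
    refine closure_minimal ?_ (hS.isClosed_biUnion fun _ _ => isClosed_closure)
    rintro _ ⟨x, rfl⟩
    obtain ⟨s, hs, hsx⟩ := hSx x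
    exact Set.mem_biUnion hs (hsx.map hf).mem_closure
  obtain ⟨s, hs, h⟩ := Set.mem_iUnion₂.mp (this hy)
  exact ⟨s, specializes_iff_mem_closure.mpr h⟩

/-- An upper bound for the dimension of a subspace of a scheme locally of finite type. -/
theorem topologicalKrullDim_le_of_ptdeg_le {K : Type} [Field K] {W : Over (SpecK K)}
    (hW : LocallyOfFiniteType W.hom) {T : Type} [TopologicalSpace T] {f : T → W.left}
    (hf : IsInducing f) {n : ℕ} (hn : ∀ x ∈ closure (Set.range f), ptdeg x ≤ n) :
    topologicalKrullDim T ≤ n := by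
  let m := TopologicalSpace.IrreducibleCloseds.map f hf.continuous
  have hm : StrictMono m := TopologicalSpace.IrreducibleCloseds.map_strictMono_of_isInducing hf
  let η (C : TopologicalSpace.IrreducibleCloseds T) : W.left := (m C).isIrreducible.genericPoint
  have hη (C) : IsGenericPoint (η C) (m C : Set W.left) := by
    have := (m C).isIrreducible.isGenericPoint_genericPoint_closure
    rwa [(m C).isClosed.closure_eq] at this
  have hηn (C) : ptdeg (η C) ≤ n := hn _ (closure_mono (Set.image_subset_range f C) (hη C).mem)
  have hlt : StrictMono fun C => Cardinal.toNat (ptdeg (η C)) := by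
    intro C D hCD
    refine Cardinal.toNat_lt_toNat ?_ (ptdeg_lt_aleph0 hW _)
    have hCD' := hm hCD
    refine ptdeg_lt_of_specializes hW ?_ ?_
    · exact (hη D).specializes (hCD'.le (hη C).mem)
    · intro h
      refine hCD'.ne (SetLike.coe_injective ?_)
      rw [← (hη C).def, ← (hη D).def, h]
  refine iSup_le fun l => ?_
  have h1 : ∀ i : Fin (l.length + 1), (i : ℕ) ≤ Cardinal.toNat (ptdeg (η (l i))) := by
    intro i
    induction i using Fin.induction with
    | zero => exact Nat.zero_le _
    | succ i ih => exact Nat.lt_of_le_of_lt ih (hlt (l.step i))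
  have h2 := h1 (Fin.last _)
  have h3 := Cardinal.toNat_le_toNat (hηn (l (Fin.last _))) Cardinal.natCast_lt_aleph0
  rw [Cardinal.toNat_natCast] at h3
  exact_mod_cast h2.trans h3

theorem topologicalKrullDim_le_closedPoints (X : Type) [TopologicalSpace X] [JacobsonSpace X] :
    topologicalKrullDim X ≤ topologicalKrullDim (closedPoints X) := by
  have hc (C : TopologicalSpace.IrreducibleCloseds X) :
      closure ((C : Set X) ∩ closedPoints X) = C := closure_inter_closedPoints C.isClosed
  have hirr (C : TopologicalSpace.IrreducibleCloseds X) :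
      IsIrreducible ((↑) ⁻¹' (C : Set X) : Set (closedPoints X)) := by
    have h : IsIrreducible ((C : Set X) ∩ closedPoints X) := by
      rw [← isIrreducible_iff_closure, hc]; exact C.isIrreducible
    obtain ⟨⟨x, hx, hx'⟩, h⟩ := h
    refine ⟨⟨⟨x, hx'⟩, hx⟩, ?_⟩
    rintro _ _ ⟨u, hu, rfl⟩ ⟨v, hv, rfl⟩ ⟨a, ha, ha'⟩ ⟨b, hb, hb'⟩
    obtain ⟨c, hc, hc'⟩ := h u v hu hv ⟨a, ⟨ha, a.2⟩, ha'⟩ ⟨b, ⟨hb, b.2⟩, hb'⟩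
    exact ⟨⟨c, hc.2⟩, hc.1, hc'⟩
  refine Order.krullDim_le_of_strictMono
    (fun C => ⟨(↑) ⁻¹' (C : Set X), hirr C, C.isClosed.preimage continuous_subtype_val⟩) ?_
  refine Monotone.strictMono_of_injective (fun C D h x hx => h hx) fun C D h => ?_
  have h' : ((↑) ⁻¹' (C : Set X) : Set (closedPoints X)) = (↑) ⁻¹' (D : Set X) :=
    congrArg TopologicalSpace.IrreducibleCloseds.carrier h
  rw [Subtype.preimage_val_eq_preimage_val_iff] at h'
  refine SetLike.coe_injective ?_
  rw [← hc C, ← hc D, Set.inter_comm, h', Set.inter_comm]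

theorem exists_algHom_ker_eq {K R : Type} [Field K] [IsAlgClosed K] [CommRing R] [Algebra K R]
    [Algebra.FiniteType K R] (M : Ideal R) [M.IsMaximal] :
    ∃ φ : R →ₐ[K] K, RingHom.ker φ = M := by
  let : Field (R ⧸ M) := Ideal.Quotient.field M
  have : Module.Finite K (R ⧸ M) := finite_of_finite_type_of_isJacobsonRing K (R ⧸ M)
  let e : K ≃ₐ[K] R ⧸ M := AlgEquiv.ofBijective (Algebra.ofId K (R ⧸ M))
    IsAlgClosed.algebraMap_bijective_of_isIntegral
  refine ⟨(e.symm : R ⧸ M →ₐ[K] K).comp (Ideal.Quotient.mkₐ K M), ?_⟩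
  ext a
  simp [Ideal.Quotient.eq_zero_iff_mem, RingHom.mem_ker]

/-- The structure morphism of the standard `K`-point. -/
def ptToSpec (K : Type) [Field K] : Over.mk (𝟙 (SpecK K)) ⟶ specOver K K :=
  Over.homMk (𝟙 _) (by
    change 𝟙 _ ≫ Spec.map (𝟙 (CommRingCat.of K)) = 𝟙 _
    rw [Spec.map_id, Category.id_comp])

theorem ev_ptToSpec_comp {K : Type} [Field K] {W : Over (SpecK K)} (s : specOver K K ⟶ W) :
    ev K (ptToSpec K ≫ s) = s.left (fieldPt K K) := rfl

/-- A lower bound for the dimension of the set of images of rational points. -/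
theorem le_topologicalKrullDim_range_ev {K : Type} [Field K] [IsAlgClosed K]
    {Y W : Over (SpecK K)} (hY : LocallyOfFiniteType Y.hom) (hW : LocallyOfFiniteType W.hom)
    (φ : Y ⟶ W) (y : Y.left) {n : ℕ} (hn : (n : Cardinal) ≤ ptdeg (φ.left y)) :
    (n : WithBot ℕ∞) ≤ topologicalKrullDim (Set.range fun a : Pt K Y => ev K (a ≫ φ)) := by
  obtain ⟨A, B, _, _, _, _, _, _, j, i, g, hj, ⟨b, rfl⟩, hij⟩ := exists_chart_hom hY hW φ y
  rw [← comp_left_apply, hij, comp_left_apply, ptdeg_map_of_isOpenImmersion, ptdeg_specOver] at hn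
  obtain ⟨R, _, _, _, _, r, hr, htr, hlift⟩ := exists_inducing_comap_maximal g b
  have h1 := le_ringKrullDim_of_le_trdeg (hn.trans htr)
  rw [← PrimeSpectrum.topologicalKrullDim_eq_ringKrullDim] at h1
  have : IsJacobsonRing R := isJacobsonRing_of_finiteType (A := K)
  refine (h1.trans (topologicalKrullDim_le_closedPoints _)).trans ?_
  let F : PrimeSpectrum R → W.left := fun M => j.left (PrimeSpectrum.comap (r : A →+* R) M)
  have hF : IsInducing F := hj.base_open.isInducing.comp hr
  have hFm (M : closedPoints (PrimeSpectrum R)) :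
      F M ∈ Set.range fun a : Pt K Y => ev K (a ≫ φ) := by
    obtain ⟨M, hM⟩ := M
    have hM' : M.asIdeal.IsMaximal := (PrimeSpectrum.isClosed_singleton_iff_isMaximal M).mp hM
    obtain ⟨m, hm⟩ := exists_algHom_ker_eq (K := K) M.asIdeal
    obtain ⟨Q, hQ⟩ := hlift M
    obtain ⟨N, hN, hQN⟩ := Q.asIdeal.exists_le_maximal Q.isPrime.ne_top
    obtain ⟨ν, hν⟩ := exists_algHom_ker_eq (K := K) N
    have hker : RingHom.ker (ν.comp g) = RingHom.ker (m.comp r) := by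
      have : (RingHom.ker (m.comp r)).IsMaximal :=
        RingHom.ker_isMaximal_of_surjective _ fun k => ⟨algebraMap K A k, AlgHom.commutes _ _⟩
      refine (this.eq_of_le (RingHom.ker_ne_top _) ?_).symm
      intro a ha
      have ha' : a ∈ (M.comap (r : A →+* R)).asIdeal := by
        change r a ∈ M.asIdeal
        rw [← hm]; exact ha
      rw [← hQ] at ha'
      have : g a ∈ N := hQN ha'
      rw [← hν] at this
      exact this
    refine ⟨ptToSpec K ≫ specOverMap ν ≫ i, ?_⟩
    change ev K ((ptToSpec K ≫ specOverMap ν ≫ i) ≫ φ) = _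
    rw [Category.assoc, Category.assoc, hij, ev_ptToSpec_comp, comp_left_apply, comp_left_apply]
    change j.left _ = j.left _
    congr 1
    apply PrimeSpectrum.ext (R := A)
    ext a
    change ν (g a) ∈ (⊥ : Ideal K) ↔ r a ∈ M.asIdeal
    rw [← hm, Ideal.mem_bot]
    exact SetLike.ext_iff.mp hker a
  have hG : IsInducing (fun M : closedPoints (PrimeSpectrum R) =>
      (⟨F M, hFm M⟩ : Set.range fun a : Pt K Y => ev K (a ≫ φ))) := by
    refine IsInducing.of_comp ?_ continuous_subtype_val ?_
    · exact (hF.continuous.comp continuous_subtype_val).subtype_mk _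
    · exact hF.comp IsInducing.subtypeVal
  exact hG.topologicalKrullDim_le

theorem over_isClosedUnderFiniteProducts {C : Type*} [Category C] [HasPullbacks C] {S : C}
    [HasFiniteProducts (Over S)] (P : MorphismProperty C) [P.IsMultiplicative]
    [P.IsStableUnderBaseChange] :
    (P.overObj (X := S)).IsClosedUnderFiniteProducts := by
  have : (P.overObj (X := S)).IsClosedUnderBinaryProducts := by
    refine ⟨fun Z ⟨p⟩ => ?_⟩
    have h := Over.isPullback_of_binaryFan_isLimit _
      ((IsLimit.postcomposeHomEquiv (diagramIsoPair p.diag) p.cone).symm p.isLimit)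
    have h1 := P.of_isPullback h.flip (p.prop_diag_obj ⟨.right⟩)
    have h2 := P.comp_mem _ _ h1 (p.prop_diag_obj ⟨.left⟩)
    rw [MorphismProperty.overObj_iff]
    have h3 : Z.hom = (p.π.app ⟨.left⟩).left ≫ (p.diag.obj ⟨.left⟩).hom :=
      (Over.w (p.π.app ⟨.left⟩)).symm
    rw [h3]
    have h4 : BinaryFan.fst ((Cone.postcompose (diagramIsoPair p.diag).hom).obj p.cone) =
      p.π.app ⟨.left⟩ := Category.comp_id _
    exact (congrArg (fun q : Z ⟶ _ => P (q.left ≫ (p.diag.obj ⟨.left⟩).hom)) h4).mp h2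
  exact ObjectProperty.IsClosedUnderFiniteProducts.mk'

theorem locallyOfFiniteType_pow {K : Type} [Field K] {V : Over (SpecK K)}
    (hV : LocallyOfFiniteType V.hom) (Ω : Type) [Finite Ω] :
    LocallyOfFiniteType (pow K V Ω).hom := by
  have := over_isClosedUnderFiniteProducts (S := SpecK K) @LocallyOfFiniteType
  exact ObjectProperty.prop_product
    (MorphismProperty.overObj (X := SpecK K) @LocallyOfFiniteType) (f := fun _ : Ω => V)
    fun _ => hV

theorem quasiCompact_pow {K : Type} [Field K] {V : Over (SpecK K)}
    (hV : QuasiCompact V.hom) (Ω : Type) [Finite Ω] :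
    QuasiCompact (pow K V Ω).hom := by
  have := over_isClosedUnderFiniteProducts (S := SpecK K) @QuasiCompact
  exact ObjectProperty.prop_product
    (MorphismProperty.overObj (X := SpecK K) @QuasiCompact) (f := fun _ : Ω => V)
    fun _ => hV

/-- The projection of a power of `V` to a coordinate. -/
def proj {K : Type} [Field K] (V : Over (SpecK K)) {Ω : Type} [Finite Ω] (ω : Ω) :
    pow K V Ω ⟶ V := Pi.π (fun _ : Ω => V) ω

/-- The morphism to a power with given coordinates. -/
def tuple {K : Type} [Field K] {V W : Over (SpecK K)} {Ω : Type} [Finite Ω] (a : Ω → (W ⟶ V)) :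
    W ⟶ pow K V Ω := Pi.lift a

theorem tuple_proj {K : Type} [Field K] {V W : Over (SpecK K)} {Ω : Type} [Finite Ω]
    (a : Ω → (W ⟶ V)) (ω : Ω) : tuple a ≫ proj V ω = a ω := Pi.lift_π _ _

theorem pow_hom_ext {K : Type} [Field K] {V W : Over (SpecK K)} {Ω : Type} [Finite Ω]
    {a b : W ⟶ pow K V Ω} (h : ∀ ω, a ≫ proj V ω = b ≫ proj V ω) : a = b := Pi.hom_ext _ _ h

theorem specOverMap_injective {K R S : Type} [Field K] [CommRing R] [CommRing S] [Algebra K R]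
    [Algebra K S] {φ ψ : R →ₐ[K] S} (h : specOverMap φ = specOverMap ψ) : φ = ψ := by
  have h1 := congrArg CommRingCat.Hom.hom (Spec.map_injective (congrArg CommaMorphism.left h))
  ext a
  exact congrArg (fun f : R →+* S => f a) h1

instance {K : Type} [Field K] (W : Over (SpecK K)) (x : W.left) : Mono (fromRes W x) := by
  have : Mono (fromRes W x).left := inferInstanceAs (Mono (W.left.fromSpecResidueField x))
  exact Over.mono_of_mono_left _

theorem exists_comp_eq_of_specOverMap_comp_eq {K L M : Type} [Field K] [Field L] [Field M]
    [Algebra K L] [Algebra K M] {W : Over (SpecK K)} {x : W.left} (t : specOver K M ⟶ W)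
    (φ : M →ₐ[K] L) (e : ResField K W x →ₐ[K] L)
    (h : specOverMap φ ≫ t = specOverMap e ≫ fromRes W x) :
    ∃ ψ : ResField K W x →ₐ[K] M, φ.comp ψ = e ∧ t = specOverMap ψ ≫ fromRes W x := by
  have hx : t.left ((specOverMap φ).left (fieldPt K L)) = x := by
    rw [← comp_left_apply, h, comp_left_apply, fromRes_apply]
  obtain ⟨ψ, hψ⟩ := exists_eq_specOverMap_fromRes t ((specOverMap φ).left (fieldPt K L))
  revert ψ
  rw [hx]
  intro ψ hψ
  refine ⟨ψ, ?_, hψ⟩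
  rw [hψ, ← Category.assoc, ← specOverMap_comp, cancel_mono] at h
  exact specOverMap_injective h

theorem exists_residue_map {K : Type} [Field K] {W W' : Over (SpecK K)} (h : W ⟶ W')
    (z : W.left) : ∃ ψ : ResField K W' (h.left z) →ₐ[K] ResField K W z,
      fromRes W z ≫ h = specOverMap ψ ≫ fromRes W' (h.left z) := by
  have hx := fromRes_apply W z (fieldPt K _)
  obtain ⟨ψ, hψ⟩ := exists_eq_specOverMap_fromRes (fromRes W z ≫ h) (fieldPt K _)
  revert ψ
  rw [comp_left_apply, hx]
  exact fun ψ hψ => ⟨ψ, hψ⟩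

/-- The residue field of a point of a power is the compositum of those of its coordinates. -/
theorem eq_top_of_residue_map_mem {K : Type} [Field K] {V : Over (SpecK K)} {Ω : Type} [Finite Ω]
    (z : (pow K V Ω).left) (L : IntermediateField K (ResField K _ z))
    (hL : ∀ (ω : Ω) (ψ : ResField K V ((proj V ω).left z) →ₐ[K] ResField K _ z),
      fromRes _ z ≫ proj V ω = specOverMap ψ ≫ fromRes V ((proj V ω).left z) → ∀ a, ψ a ∈ L) :
    L = ⊤ := by
  choose ψ hψ using fun ω : Ω => exists_residue_map (proj V ω) z
  let ψ' (ω : Ω) : ResField K V ((proj V ω).left z) →ₐ[K] L :=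
    (ψ ω).codRestrict L.toSubalgebra (hL ω _ (hψ ω))
  let u : specOver K L ⟶ pow K V Ω := tuple fun ω => specOverMap (ψ' ω) ≫ fromRes V _
  have hu : specOverMap L.val ≫ u =
      specOverMap (AlgHom.id K (ResField K _ z)) ≫ fromRes _ z := by
    refine pow_hom_ext fun ω => ?_
    rw [Category.assoc, Category.assoc, tuple_proj, hψ, ← Category.assoc, ← Category.assoc,
      ← specOverMap_comp, ← specOverMap_comp]
    rfl
  obtain ⟨σ, hσ, -⟩ := exists_comp_eq_of_specOverMap_comp_eq u L.val _ hu
  refine eq_top_iff.mpr fun a _ => ?_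
  have : L.val (σ a) = a := DFunLike.congr_fun hσ a
  rw [← this]
  exact (σ a).2

theorem trdeg_le_sum_of_iSup_eq_top {K E : Type} [Field K] [Field E] [Algebra K E] {J : Type}
    (F : J → IntermediateField K E) (h : ⨆ j, F j = ⊤) :
    Algebra.trdeg K E ≤ Cardinal.sum fun j => Algebra.trdeg K (F j) := by
  choose ι x hx using fun j => exists_isTranscendenceBasis' K (F j)
  let S : Set E := Set.range fun p : Σ j, ι j => (x p.1 p.2 : E)
  let F₀ := IntermediateField.adjoin K S
  let L := (algebraicClosure F₀ E).restrictScalars K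
  have hL : L = ⊤ := by
    rw [← top_le_iff, ← h]
    refine iSup_le fun j a ha => ?_
    have h1 := (hx j).isAlgebraic.isAlgebraic (⟨a, ha⟩ : F j)
    have h2 : Algebra.adjoin K (Set.range (x j)) ≤ F₀.toSubalgebra.comap (F j).val := by
      refine Algebra.adjoin_le ?_
      rintro _ ⟨i, rfl⟩
      exact IntermediateField.subset_adjoin K S ⟨⟨j, i⟩, rfl⟩
    let f : Algebra.adjoin K (Set.range (x j)) →ₐ[K] F₀ :=
      ((F j).val.comp (Subalgebra.val _)).codRestrict F₀.toSubalgebra fun a => h2 a.2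
    have hf : Function.Injective f := fun a b hab =>
      Subtype.ext (Subtype.ext (congrArg (fun c : F₀ => (c : E)) hab))
    have h3 := h1.ringHom_of_comp_eq f (F j).val hf rfl
    exact (mem_algebraicClosure_iff (F := F₀)).mpr h3
  have : Algebra.IsAlgebraic (Algebra.adjoin K S) E := by
    rw [← IntermediateField.isAlgebraic_adjoin_iff_top]
    refine ⟨fun a => ?_⟩
    have : a ∈ L := hL ▸ IntermediateField.mem_top
    exact (mem_algebraicClosure_iff (F := F₀)).mp this
  refine (Algebra.IsAlgebraic.trdeg_le_cardinalMk K S).trans (Cardinal.mk_range_le.trans ?_)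
  rw [Cardinal.mk_sigma]
  simp [(hx _).cardinalMk_eq_trdeg]

/-- The restriction of a power of `V` to a smaller index set. -/
def reindex {K : Type} [Field K] (V : Over (SpecK K)) {Ω Ω' : Type} [Finite Ω] [Finite Ω']
    (i : Ω → Ω') : pow K V Ω' ⟶ pow K V Ω := tuple fun ω => proj V (i ω)

theorem trdeg_fieldRange_le {K F E : Type} [Field K] [Field E] [Field F] [Algebra K F]
    [Algebra K E] (ψ : F →ₐ[K] E) : Algebra.trdeg K ψ.fieldRange ≤ Algebra.trdeg K F :=
  (trdeg_le_of_surjective ψ.rangeRestrict ψ.rangeRestrict_surjective)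

theorem sum_option_elim {E : Type} (c : Cardinal.{0}) (d : E → Cardinal.{0}) :
    Cardinal.sum (fun o : Option E => o.elim c d) = c + Cardinal.sum d := by
  have h : Cardinal.sum (fun o : Option E => o.elim c d) =
      Cardinal.sum (fun o : E ⊕ Unit => o.elim d fun _ => c) :=
    Cardinal.mk_congr ((Equiv.optionEquivSumPUnit E).sigmaCongr fun o => Equiv.cast (by
      cases o <;> rfl))
  have h' : Cardinal.sum (fun o : E ⊕ Unit => o.elim d fun _ => c) =
      Cardinal.sum d + Cardinal.sum (fun _ : Unit => c) :=
    Cardinal.mk_congr (Equiv.sumSigmaDistrib _)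
  rw [h, h', add_comm, Cardinal.sum_const']
  simp

theorem ptdeg_pow_le {K : Type} [Field K] {V : Over (SpecK K)} {Ω Ω' E : Type} [Finite Ω]
    [Finite Ω'] (i : Ω → Ω') (j : E → Ω') (hij : ∀ ω', (∃ ω, i ω = ω') ∨ ∃ e, j e = ω')
    (z : (pow K V Ω').left) :
    ptdeg z ≤ ptdeg ((reindex V i).left z) +
      Cardinal.sum fun e => ptdeg ((proj V (j e)).left z) := by
  classical
  obtain ⟨ρ, hρ⟩ := exists_residue_map (reindex V i) z
  choose ψ hψ using fun ω : Ω' => exists_residue_map (proj V ω) z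
  let F (o : Option E) : IntermediateField K (ResField K _ z) :=
    o.elim ρ.fieldRange fun e => (ψ (j e)).fieldRange
  have hF : ⨆ o, F o = ⊤ := by
    refine eq_top_of_residue_map_mem z _ fun ω' ψ' hψ' a => ?_
    rcases hij ω' with ⟨ω, rfl⟩ | ⟨e, rfl⟩
    · obtain ⟨σ, hσ, -⟩ := exists_comp_eq_of_specOverMap_comp_eq
        (fromRes _ _ ≫ proj V ω) ρ ψ' (by
          rw [← hψ', ← Category.assoc, ← hρ, Category.assoc, reindex, tuple_proj])
      rw [← hσ]
      exact le_iSup F none ⟨σ a, rfl⟩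
    · have : ψ' = ψ (j e) := by
        rw [hψ, cancel_mono] at hψ'
        exact (specOverMap_injective hψ').symm
      rw [this]
      exact le_iSup F (some e) ⟨a, rfl⟩
  refine (trdeg_le_sum_of_iSup_eq_top F hF).trans ?_
  rw [← sum_option_elim]
  refine Cardinal.sum_le_sum _ _ fun o => ?_
  cases o
  · exact trdeg_fieldRange_le ρ
  · exact trdeg_fieldRange_le (ψ _)

theorem _root_.IsTranscendenceBasis.exists_algHom_apply_eq {K F L ι : Type} [Field K] [Field F]
    [Field L] [IsAlgClosed L] [Algebra K F] [Algebra K L] {b : ι → F} {y : ι → L}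
    (hb : IsTranscendenceBasis K b) (hy : AlgebraicIndependent K y) :
    ∃ e : F →ₐ[K] L, ∀ i, e (b i) = y i := by
  let f : Algebra.adjoin K (Set.range b) →ₐ[K] L :=
    (MvPolynomial.aeval y).comp hb.1.aevalEquiv.symm
  have hy' : Function.Injective (MvPolynomial.aeval (R := K) y) := hy
  have hf : Function.Injective f := hy'.comp hb.1.aevalEquiv.symm.injective
  have := hb.isAlgebraic
  let : Algebra (Algebra.adjoin K (Set.range b)) L := f.toRingHom.toAlgebra
  have : IsScalarTower K (Algebra.adjoin K (Set.range b)) L :=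
    IsScalarTower.of_algebraMap_eq fun k => (f.commutes k).symm
  have : FaithfulSMul (Algebra.adjoin K (Set.range b)) L :=
    (faithfulSMul_iff_algebraMap_injective _ _).mpr hf
  let e : F →ₐ[Algebra.adjoin K (Set.range b)] L := IsAlgClosed.lift
  refine ⟨e.restrictScalars K, fun i => ?_⟩
  have h1 := e.commutes ⟨b i, Algebra.subset_adjoin ⟨i, rfl⟩⟩
  have h2 : hb.1.aevalEquiv (.X i) = ⟨b i, Algebra.subset_adjoin ⟨i, rfl⟩⟩ :=
    Subtype.ext (by simp)
  refine h1.trans ?_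
  change MvPolynomial.aeval y (hb.1.aevalEquiv.symm _) = _
  rw [← h2, AlgEquiv.symm_apply_apply, MvPolynomial.aeval_X]

/-- A power of `V` has a point at which the transcendence degrees of the coordinates add up. -/
theorem exists_le_ptdeg_pow {K : Type} [Field K] {V : Over (SpecK K)} (x : V.left)
    (Ω : Type) [Finite Ω] :
    ∃ z : (pow K V Ω).left, Cardinal.mk Ω * ptdeg x ≤ ptdeg z := by
  obtain ⟨ι, b, hb⟩ := exists_isTranscendenceBasis' K (ResField K V x)
  let L := AlgebraicClosure (FractionRing (MvPolynomial (Ω × ι) K))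
  let X (p : Ω × ι) : L := algebraMap (MvPolynomial (Ω × ι) K) L (.X p)
  have hX : AlgebraicIndependent K X :=
    (MvPolynomial.algebraicIndependent_X (Ω × ι) K).map'
      (f := IsScalarTower.toAlgHom K (MvPolynomial (Ω × ι) K) L)
      (by
        change Function.Injective (algebraMap (MvPolynomial (Ω × ι) K) L)
        rw [IsScalarTower.algebraMap_eq _ (FractionRing (MvPolynomial (Ω × ι) K)) L]
        exact (FaithfulSMul.algebraMap_injective (FractionRing (MvPolynomial (Ω × ι) K)) L).comp
          (IsFractionRing.injective _ _))
  have he (ω : Ω) : ∃ e : ResField K V x →ₐ[K] L, ∀ i, e (b i) = X (ω, i) :=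
    hb.exists_algHom_apply_eq (hX.comp (fun i => (ω, i)) (Prod.mk_right_injective ω))
  choose e he using he
  let s : specOver K L ⟶ pow K V Ω := tuple fun ω => specOverMap (e ω) ≫ fromRes V x
  refine ⟨s.left (fieldPt K L), ?_⟩
  obtain ⟨φ, hφ⟩ := exists_eq_specOverMap_fromRes s (fieldPt K L)
  have hψ (ω : Ω) := exists_comp_eq_of_specOverMap_comp_eq (fromRes _ _ ≫ proj V ω) φ (e ω) (by
    rw [← Category.assoc, ← hφ, tuple_proj])
  choose ψ hψ _ using hψ
  have hY : AlgebraicIndependent K fun p : Ω × ι => ψ p.1 (b p.2) := by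
    refine AlgebraicIndependent.of_comp φ ?_
    convert hX using 1
    ext p
    rw [← he p.1 p.2, ← hψ p.1]
    rfl
  refine le_trans (le_of_eq ?_) hY.cardinalMk_le_trdeg
  rw [Cardinal.mk_prod, ptdeg, hb.cardinalMk_eq_trdeg]
  simp

theorem ptdeg_pow_of_isEmpty {K : Type} [Field K] {V : Over (SpecK K)} {Ω : Type} [Finite Ω]
    [IsEmpty Ω] (z : (pow K V Ω).left) : ptdeg z = 0 := by
  have h := trdeg_le_sum_of_iSup_eq_top (fun e : Empty => e.elim)
    (eq_top_of_residue_map_mem z _ fun ω => isEmptyElim ω)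
  rw [Cardinal.sum, Cardinal.mk_eq_zero] at h
  exact le_antisymm h zero_le

theorem ptdeg_pow_le_card_mul {K : Type} [Field K] {V : Over (SpecK K)} {Ω : Type} [Finite Ω]
    {d : Cardinal.{0}} (hd : ∀ x : V.left, ptdeg x ≤ d) (z : (pow K V Ω).left) :
    ptdeg z ≤ Cardinal.mk Ω * d := by
  refine (ptdeg_pow_le (Ω := Empty) (fun e => e.elim) id (fun ω => .inr ⟨ω, rfl⟩) z).trans ?_
  rw [ptdeg_pow_of_isEmpty, zero_add, ← Cardinal.sum_const']
  exact Cardinal.sum_le_sum _ _ fun _ => hd _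

/-- The transcendence degree attains a finite maximum along a morphism. -/
theorem exists_forall_ptdeg_le {K : Type} [Field K] {Y W : Over (SpecK K)}
    (hY : LocallyOfFiniteType Y.hom) (hY' : QuasiCompact Y.hom) (hW : LocallyOfFiniteType W.hom)
    (φ : Y ⟶ W) [Nonempty Y.left] :
    ∃ (y : Y.left) (n : ℕ), ptdeg (φ.left y) = n ∧ ∀ y', ptdeg (φ.left y') ≤ n := by
  have := noetherianSpace_of_finiteType hY hY'
  obtain ⟨S, hS, hSy⟩ := exists_finite_forall_specializes Y.left
  have hS' : S.Nonempty := by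
    obtain ⟨s, hs, -⟩ := hSy (Classical.arbitrary _)
    exact ⟨s, hs⟩
  obtain ⟨y, -, hy⟩ := hS.exists_maximalFor (fun s => ptdeg (φ.left s)) S hS'
  obtain ⟨n, hn⟩ := Cardinal.lt_aleph0.mp (ptdeg_lt_aleph0 hW (φ.left y))
  refine ⟨y, n, hn, fun y' => ?_⟩
  obtain ⟨s, hs, hsy⟩ := hSy y'
  rw [← hn]
  refine (ptdeg_le_of_specializes hW (hsy.map φ.left.continuous)).trans ?_
  exact (le_total _ _).elim id fun h => hy hs h

/-- The point of the power of `V` underlying a family of rational points. -/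
def cfgPt (K : Type) [Field K] (V : Over (SpecK K)) (Ω : Type) [Finite Ω] (u : Ω → Pt K V) :
    (pow K V Ω).left := ev K (ptPow K V Ω u)

theorem cfgDim_le {K : Type} [Field K] {V : Over (SpecK K)} (hV : LocallyOfFiniteType V.hom)
    {Ω : Type} [Finite Ω] {D : Set (Ω → Pt K V)} {n : ℕ}
    (hn : ∀ x ∈ closure (cfgPt K V Ω '' D), ptdeg x ≤ n) : cfgDim K V Ω D ≤ n := by
  let := cfgTop K V Ω
  have h1 : IsInducing (cfgPt K V Ω) := ⟨rfl⟩
  refine topologicalKrullDim_le_of_ptdeg_le (locallyOfFiniteType_pow hV Ω)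
    (f := fun u : D => cfgPt K V Ω u) (h1.comp IsInducing.subtypeVal) ?_
  rwa [← Set.image_eq_range]

theorem le_cfgDim {K : Type} [Field K] [IsAlgClosed K] {V Y : Over (SpecK K)}
    (hV : LocallyOfFiniteType V.hom) (hY : LocallyOfFiniteType Y.hom)
    {Ω : Type} [Finite Ω] {D : Set (Ω → Pt K V)} (φ : Y ⟶ pow K V Ω)
    (hD : ∀ a : Pt K Y, ∃ u ∈ D, cfgPt K V Ω u = ev K (a ≫ φ))
    (y : Y.left) {n : ℕ} (hn : n ≤ ptdeg (φ.left y)) : n ≤ cfgDim K V Ω D := by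
  let := cfgTop K V Ω
  have h1 : IsInducing (cfgPt K V Ω) := ⟨rfl⟩
  have h2 : IsInducing (fun u : D => cfgPt K V Ω u) := h1.comp IsInducing.subtypeVal
  have hs (x : Set.range fun a : Pt K Y => ev K (a ≫ φ)) : ∃ u : D, cfgPt K V Ω u = x := by
    obtain ⟨_, a, rfl⟩ := x
    obtain ⟨u, hu, h⟩ := hD a
    exact ⟨⟨u, hu⟩, h⟩
  choose s hs using hs
  have h3 : (fun u : D => cfgPt K V Ω u) ∘ s = Subtype.val := funext hs
  have h4 : IsInducing s := by
    refine IsInducing.of_comp (h2.continuous_iff.mpr ?_) h2.continuous ?_ <;> rw [h3]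
    · exact continuous_subtype_val
    · exact IsInducing.subtypeVal
  exact (le_topologicalKrullDim_range_ev hY (locallyOfFiniteType_pow hV Ω) φ y hn).trans
    h4.topologicalKrullDim_le

theorem vdim_eq {K : Type} [Field K] [IsAlgClosed K] {V : Over (SpecK K)}
    (hV : LocallyOfFiniteType V.hom) {n : ℕ} (hn : ∀ x : V.left, ptdeg x ≤ n) (x : V.left)
    (hx : n ≤ ptdeg x) : vdim K V = n := by
  refine le_antisymm (topologicalKrullDim_le_of_ptdeg_le hV IsInducing.id fun x _ => hn x) ?_
  exact (le_topologicalKrullDim_range_ev hV hV (𝟙 V) x hx).trans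
    IsInducing.subtypeVal.topologicalKrullDim_le

theorem topologicalKrullDim_of_isEmpty (T : Type) [TopologicalSpace T] [IsEmpty T] :
    topologicalKrullDim T = ⊥ := by
  have : IsEmpty (TopologicalSpace.IrreducibleCloseds T) :=
    ⟨fun C => isEmptyElim C.isIrreducible.nonempty.choose⟩
  exact Order.krullDim_eq_bot

theorem nonempty_pt {K : Type} [Field K] [IsAlgClosed K] {V : Over (SpecK K)}
    (hV : LocallyOfFiniteType V.hom) [Nonempty V.left] : Nonempty (Pt K V) := by
  have h := le_topologicalKrullDim_range_ev hV hV (𝟙 V) (Classical.arbitrary _) (n := 0)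
    (by simp)
  by_contra hne
  rw [not_nonempty_iff] at hne
  have : IsEmpty (Set.range fun a : Pt K V => ev K (a ≫ 𝟙 V)) :=
    ⟨by rintro ⟨_, a, -⟩; exact hne.elim a⟩
  rw [topologicalKrullDim_of_isEmpty] at h
  simp at h

theorem le_cfgDim_univ {K : Type} [Field K] [IsAlgClosed K] {V : Over (SpecK K)}
    (hV : LocallyOfFiniteType V.hom) {n : ℕ} (x : V.left) (hx : n ≤ ptdeg x)
    (Ω : Type) [Finite Ω] : (Nat.card Ω * n : ℕ) ≤ cfgDim K V Ω Set.univ := by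
  obtain ⟨z, hz⟩ := exists_le_ptdeg_pow x Ω
  refine le_cfgDim hV (locallyOfFiniteType_pow hV Ω) (𝟙 _)
    (fun a => ⟨fun ω => a ≫ proj V ω, Set.mem_univ _, ?_⟩) z (le_trans ?_ hz)
  · have : ptPow K V Ω (fun ω => a ≫ proj V ω) = a ≫ 𝟙 _ :=
      pow_hom_ext fun ω => by rw [Category.comp_id]; exact tuple_proj _ ω
    rw [← this]; rfl
  · push_cast
    rw [Nat.cast_card]
    gcongr

open scoped Classical in
/-- The cells on which the image of a cellular automaton with memory set `M` depends. -/
def nbhd {G : Type} [Group G] (M Ω : Finset G) : Finset G := (Ω ×ˢ M).image fun p => p.1 * p.2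

theorem mul_mem_nbhd {G : Type} [Group G] {M Ω : Finset G} {g m : G} (hg : g ∈ Ω) (hm : m ∈ M) :
    g * m ∈ nbhd M Ω := by
  classical
  exact Finset.mem_image.mpr ⟨(g, m), Finset.mk_mem_product hg hm, rfl⟩

theorem nbhd_mono {G : Type} [Group G] {M Ω Ω' : Finset G} (h : Ω ⊆ Ω') :
    nbhd M Ω ⊆ nbhd M Ω' := by
  classical
  exact Finset.image_subset_image (Finset.product_subset_product_left h)

/-- The morphism of powers induced by a cellular automaton. -/
def blockMap {K : Type} [Field K] {V : Over (SpecK K)} {G : Type} [Group G] {M : Finset G}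
    (f : pow K V ↥M ⟶ V) (Ω : Finset G) : pow K V ↥(nbhd M Ω) ⟶ pow K V ↥Ω :=
  tuple fun ω => reindex V (fun m : ↥M => (⟨ω * m, mul_mem_nbhd ω.2 m.2⟩ : ↥(nbhd M Ω))) ≫ f

theorem tuple_reindex {K : Type} [Field K] {V W : Over (SpecK K)} {Ω Ω' : Type} [Finite Ω]
    [Finite Ω'] (a : Ω' → (W ⟶ V)) (i : Ω → Ω') :
    tuple a ≫ reindex V i = tuple fun ω => a (i ω) :=
  pow_hom_ext fun ω => by
    rw [Category.assoc, reindex, tuple_proj, tuple_proj, tuple_proj]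

theorem reindex_comp {K : Type} [Field K] {V : Over (SpecK K)} {Ω Ω' Ω'' : Type} [Finite Ω]
    [Finite Ω'] [Finite Ω''] (i : Ω → Ω') (j : Ω' → Ω'') :
    reindex V j ≫ reindex V i = reindex V (j ∘ i) :=
  tuple_reindex _ _

theorem tuple_comp_blockMap {K : Type} [Field K] {V W : Over (SpecK K)} {G : Type} [Group G]
    {M : Finset G} (f : pow K V ↥M ⟶ V) (Ω : Finset G) (x : G → (W ⟶ V)) :
    tuple (fun γ : ↥(nbhd M Ω) => x γ) ≫ blockMap f Ω =
      tuple fun ω : ↥Ω => tuple (fun m : ↥M => x (ω * m)) ≫ f :=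
  pow_hom_ext fun ω => by
    rw [Category.assoc, blockMap, tuple_proj, tuple_proj, ← Category.assoc, tuple_reindex]

theorem blockMap_reindex {K : Type} [Field K] {V : Over (SpecK K)} {G : Type} [Group G]
    {M : Finset G} (f : pow K V ↥M ⟶ V) {Ω Ω' : Finset G} (h : Ω ⊆ Ω') :
    blockMap f Ω' ≫ reindex V (Set.inclusion h) =
      reindex V (Set.inclusion (nbhd_mono (M := M) h)) ≫ blockMap f Ω :=
  pow_hom_ext fun ω => by
    rw [Category.assoc, Category.assoc, blockMap, blockMap, reindex, tuple_proj, tuple_proj,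
      tuple_proj, ← Category.assoc, reindex_comp]
    rfl

/-- The maximal transcendence degree of a point in the image of the morphism of powers induced
by a cellular automaton is `n`. -/
def IsImageDim {K : Type} [Field K] {V : Over (SpecK K)} {G : Type} [Group G] {M : Finset G}
    (f : pow K V ↥M ⟶ V) (Ω : Finset G) (n : ℕ) : Prop :=
  (∃ y, ptdeg ((blockMap f Ω).left y) = n) ∧ ∀ y, ptdeg ((blockMap f Ω).left y) ≤ n

theorem exists_isImageDim {K : Type} [Field K] {V : Over (SpecK K)} {G : Type} [Group G]
    {M : Finset G} (hV : LocallyOfFiniteType V.hom) (hV' : QuasiCompact V.hom) [Nonempty V.left]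
    (f : pow K V ↥M ⟶ V) (Ω : Finset G) : ∃ n, IsImageDim f Ω n := by
  have : Nonempty (pow K V ↥(nbhd M Ω)).left :=
    ⟨(exists_le_ptdeg_pow (Classical.arbitrary V.left) _).choose⟩
  obtain ⟨y, n, h⟩ := exists_forall_ptdeg_le (locallyOfFiniteType_pow hV _)
    (quasiCompact_pow hV' _) (locallyOfFiniteType_pow hV _) (blockMap f Ω)
  exact ⟨n, ⟨y, h.1⟩, h.2⟩

theorem IsImageDim.le_card_mul {K : Type} [Field K] {V : Over (SpecK K)} {G : Type} [Group G]
    {M : Finset G} {f : pow K V ↥M ⟶ V} {Ω : Finset G} {n d : ℕ} (hn : IsImageDim f Ω n)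
    (hd : ∀ x : V.left, ptdeg x ≤ d) : n ≤ Ω.card * d := by
  obtain ⟨y, hy⟩ := hn.1
  have := ptdeg_pow_le_card_mul hd ((blockMap f Ω).left y)
  rw [hy, Cardinal.mk_coe_finset] at this
  exact_mod_cast this

open scoped Classical in
theorem IsImageDim.le_add {K : Type} [Field K] {V : Over (SpecK K)} {G : Type} [Group G]
    {M : Finset G} {f : pow K V ↥M ⟶ V} {Ω Ω' : Finset G} {n n' d : ℕ} (hn : IsImageDim f Ω n)
    (hn' : IsImageDim f Ω' n') (hd : ∀ x : V.left, ptdeg x ≤ d) (h : Ω ⊆ Ω') :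
    n' ≤ n + (Ω' \ Ω).card * d := by
  obtain ⟨y, hy⟩ := hn'.1
  have h1 := ptdeg_pow_le (V := V) (Set.inclusion h)
    (fun e : ↥(Ω' \ Ω) => (⟨e, (Finset.mem_sdiff.mp e.2).1⟩ : ↥Ω'))
    (fun ω' => if hω : (ω' : G) ∈ Ω then .inl ⟨⟨ω', hω⟩, rfl⟩
      else .inr ⟨⟨ω', Finset.mem_sdiff.mpr ⟨ω'.2, hω⟩⟩, rfl⟩) ((blockMap f Ω').left y)
  have h2 : ptdeg ((reindex V (Set.inclusion h)).left ((blockMap f Ω').left y)) ≤ n := by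
    rw [← comp_left_apply, blockMap_reindex f h, comp_left_apply]
    exact hn.2 _
  have h3 := h1.trans (add_le_add h2
    (Cardinal.sum_le_sum _ (fun _ => (d : Cardinal)) fun e => hd _))
  rw [hy, Cardinal.sum_const', Cardinal.mk_coe_finset] at h3
  exact_mod_cast h3

/-- Formula for the action of `τ` in terms of its memory set and local defining morphism. -/
def IsDefinedBy {K : Type} [Field K] {V : Over (SpecK K)} {G : Type} [Group G] {M : Finset G}
    (τ : (G → Pt K V) → G → Pt K V) (f : pow K V ↥M ⟶ V) : Prop :=
  ∀ x g, τ x g = ptPow K V ↥M (fun m => x (g * (m : G))) ≫ f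

theorem IsDefinedBy.ptPow_eq {K : Type} [Field K] {V : Over (SpecK K)} {G : Type} [Group G]
    {M : Finset G} {τ : (G → Pt K V) → G → Pt K V} {f : pow K V ↥M ⟶ V} (hτ : IsDefinedBy τ f)
    (x : G → Pt K V) (Ω : Finset G) :
    ptPow K V ↥Ω (fun ω => τ x ω) = ptPow K V ↥(nbhd M Ω) (fun γ => x γ) ≫ blockMap f Ω := by
  refine Eq.trans ?_ (tuple_comp_blockMap f Ω x).symm
  exact congrArg tuple (funext fun ω => hτ x ω)

theorem IsDefinedBy.cfgDim_le {K : Type} [Field K] {V : Over (SpecK K)} {G : Type} [Group G]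
    {M : Finset G} {τ : (G → Pt K V) → G → Pt K V} {f : pow K V ↥M ⟶ V} (hτ : IsDefinedBy τ f)
    (hV : LocallyOfFiniteType V.hom) (hV' : QuasiCompact V.hom) {Ω : Finset G} {n : ℕ}
    (hn : IsImageDim f Ω n) {D : Set (↥Ω → Pt K V)} (hD : D ⊆ restr K V (Set.range τ) Ω) :
    cfgDim K V ↥Ω D ≤ n := by
  refine GOE.cfgDim_le hV fun z hz => ?_
  have := noetherianSpace_of_finiteType (locallyOfFiniteType_pow hV ↥(nbhd M Ω))
    (quasiCompact_pow hV' ↥(nbhd M Ω))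
  have hsub : cfgPt K V ↥Ω '' D ⊆ Set.range (blockMap f Ω).left := by
    rintro _ ⟨u, hu, rfl⟩
    obtain ⟨_, ⟨x, rfl⟩, rfl⟩ := hD hu
    refine ⟨cfgPt K V _ fun γ => x γ, ?_⟩
    have := hτ.ptPow_eq x Ω
    unfold cfgPt
    rw [this]
    rfl
  obtain ⟨y, hy⟩ := closure_range_subset (blockMap f Ω).left.continuous (closure_mono hsub hz)
  exact (ptdeg_le_of_specializes (locallyOfFiniteType_pow hV _) hy).trans (hn.2 y)

theorem IsDefinedBy.le_cfgDim {K : Type} [Field K] [IsAlgClosed K] {V : Over (SpecK K)} {G : Type}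
    [Group G] {M : Finset G} {τ : (G → Pt K V) → G → Pt K V} {f : pow K V ↥M ⟶ V}
    (hτ : IsDefinedBy τ f) (hV : LocallyOfFiniteType V.hom) [Nonempty V.left]
    {Ω : Finset G} {n : ℕ} (hn : IsImageDim f Ω n) :
    n ≤ cfgDim K V ↥Ω (restr K V (Set.range τ) Ω) := by
  classical
  obtain ⟨y, hy⟩ := hn.1
  obtain ⟨b⟩ := nonempty_pt hV
  refine GOE.le_cfgDim hV (locallyOfFiniteType_pow hV _) (blockMap f Ω) (fun a => ?_) y hy.ge
  let x (g : G) : Pt K V := if hg : g ∈ nbhd M Ω then a ≫ proj V ⟨g, hg⟩ else b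
  have hx : ptPow K V ↥(nbhd M Ω) (fun γ => x γ) = a := pow_hom_ext fun γ => by
    refine (tuple_proj _ γ).trans ?_
    simp [x]
  refine ⟨fun ω => τ x ω, ⟨_, ⟨x, rfl⟩, rfl⟩, ?_⟩
  have := hτ.ptPow_eq x Ω
  unfold cfgPt
  rw [this, hx]

theorem IsDefinedBy.cfgDim_restr_range {K : Type} [Field K] [IsAlgClosed K] {V : Over (SpecK K)}
    {G : Type} [Group G] {M : Finset G} {τ : (G → Pt K V) → G → Pt K V} {f : pow K V ↥M ⟶ V}
    (hτ : IsDefinedBy τ f) (hV : LocallyOfFiniteType V.hom) (hV' : QuasiCompact V.hom)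
    [Nonempty V.left] {Ω : Finset G} {n : ℕ} (hn : IsImageDim f Ω n) :
    cfgDim K V ↥Ω (restr K V (Set.range τ) Ω) = n :=
  (hτ.cfgDim_le hV hV' hn subset_rfl).antisymm (hτ.le_cfgDim hV hn)

open scoped Classical in
/-- The cells of the image of a cellular automaton with memory set `M` that depend on `Ω`,
together with `Ω`. -/
def conbhd {G : Type} [Group G] (M Ω : Finset G) : Finset G :=
  Ω ∪ M.biUnion fun m => Ω.image (· * m⁻¹)

open scoped Classical in
theorem image_cyl_eq {K : Type} [Field K] {V : Over (SpecK K)} {G : Type} [Group G]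
    {M : Finset G} {τ : (G → Pt K V) → G → Pt K V} {f : pow K V ↥M ⟶ V} (hτ : IsDefinedBy τ f)
    [Nonempty (Pt K V)] (Ω : Finset G) (p : {g : G // g ∉ Ω} → Pt K V) :
    ∃ (R : Set (↥(conbhd M Ω) → Pt K V)) (s : {g : G // g ∉ conbhd M Ω} → Pt K V),
      τ '' cyl K V Ω Set.univ p = cyl K V (conbhd M Ω) R s ∧
        R ⊆ restr K V (Set.range τ) (conbhd M Ω) := by
  obtain ⟨b⟩ := ‹Nonempty (Pt K V)›
  let x₀ (g : G) : Pt K V := if hg : g ∈ Ω then b else p ⟨g, hg⟩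
  have key (x : G → Pt K V) (hx : x ∈ cyl K V Ω Set.univ p) (g : G) (hg : g ∉ conbhd M Ω) :
      τ x g = τ x₀ g := by
    rw [hτ, hτ]
    congr 2
    funext m
    have hgm : g * m ∉ Ω := fun h => hg <| Finset.mem_union_right _ <|
      Finset.mem_biUnion.mpr ⟨m, m.2, Finset.mem_image.mpr ⟨_, h, by simp⟩⟩
    rw [hx.2 _ hgm]
    simp [x₀, hgm]
  refine ⟨restr K V (τ '' cyl K V Ω Set.univ p) (conbhd M Ω), fun g => τ x₀ g, ?_,
    Set.image_mono (Set.image_subset_range _ _)⟩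
  ext c
  constructor
  · rintro ⟨x, hx, rfl⟩
    exact ⟨⟨_, ⟨x, hx, rfl⟩, rfl⟩, fun g hg => key x hx g hg⟩
  · rintro ⟨⟨_, ⟨x, hx, rfl⟩, hxc⟩, hc⟩
    refine ⟨x, hx, funext fun g => ?_⟩
    by_cases hg : g ∈ conbhd M Ω
    · exact congrFun hxc ⟨g, hg⟩
    · rw [hc g hg]
      exact key x hx g hg

theorem StarStarPreInjective.card_mul_le {K : Type} [Field K] [IsAlgClosed K] {V : Over (SpecK K)}
    {G : Type} [Group G] {M : Finset G} {τ : (G → Pt K V) → G → Pt K V}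
    (hss : StarStarPreInjective K V τ) {f : pow K V ↥M ⟶ V}
    (hτ : IsDefinedBy τ f) (hV : LocallyOfFiniteType V.hom) (hV' : QuasiCompact V.hom)
    (x : V.left) {d : ℕ} (hx : d ≤ ptdeg x) (Ω : Finset G) {n : ℕ}
    (hn : IsImageDim f (conbhd M Ω) n) : Ω.card * d ≤ n := by
  by_contra! hlt
  have : Nonempty V.left := ⟨x⟩
  have := nonempty_pt hV
  refine hss ⟨Ω, fun p => ?_⟩
  obtain ⟨R, s, h, hR⟩ := image_cyl_eq hτ Ω p
  refine ⟨_, R, s, h, (hτ.cfgDim_le hV hV' hn hR).trans_lt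
    (lt_of_lt_of_le ?_ (le_cfgDim_univ hV x hx ↥Ω))⟩
  rw [Nat.card_eq_fintype_card, Fintype.card_coe]
  exact_mod_cast hlt

open scoped Classical in
theorem card_conbhd_sdiff_le {G : Type} [Group G] (M Ω : Finset G) :
    (conbhd M Ω \ Ω).card ≤ ∑ m ∈ M, ((Ω : Set G) \ ((· * m) '' (Ω : Set G))).ncard := by
  have h1 : conbhd M Ω \ Ω ⊆ M.biUnion fun m => Ω.image (· * m⁻¹) \ Ω := by
    intro g hg
    simp only [conbhd, Finset.mem_sdiff, Finset.mem_union, Finset.mem_biUnion] at hg ⊢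
    tauto
  refine (Finset.card_le_card h1).trans (Finset.card_biUnion_le.trans
    (Finset.sum_le_sum fun m _ => ?_))
  have h2 : (Ω : Set G) \ ((· * m) '' (Ω : Set G)) = ↑(Ω \ Ω.image (· * m)) := by simp
  rw [h2, Set.ncard_coe_finset]
  refine Finset.card_le_card_of_injOn (· * m) (fun g hg => ?_) (mul_left_injective m).injOn
  simp only [Finset.coe_sdiff, Finset.coe_image, Set.mem_sdiff, Set.mem_image, Finset.mem_coe]
    at hg ⊢
  obtain ⟨⟨w, hw, rfl⟩, hg⟩ := hg
  exact ⟨by simpa using hw, fun ⟨v, hv, h⟩ => hg (mul_right_cancel h ▸ hv)⟩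

theorem tendsto_div_card {G : Type} [Group G] (𝓕 : FolnerNet G) (M : Finset G) {t : 𝓕.ι → ℕ}
    {d : ℕ} (h1 : ∀ i, t i ≤ (𝓕.F i).card * d)
    (h2 : ∀ i, (𝓕.F i).card * d ≤ t i +
      (∑ m ∈ M, ((𝓕.F i : Set G) \ ((· * m) '' (𝓕.F i : Set G))).ncard) * d) :
    Tendsto (fun i => (t i : ℝ) * ((𝓕.F i).card : ℝ)⁻¹) atTop (𝓝 d) := by
  have hpos (i) : (0 : ℝ) < (𝓕.F i).card := by exact_mod_cast (𝓕.nonempty i).card_pos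
  have hlim := tendsto_finsetSum M fun m _ => 𝓕.folner m
  have hlim' := tendsto_const_nhds (x := (d : ℝ)).sub (hlim.mul_const (d : ℝ))
  simp only [Finset.sum_const_zero, zero_mul, sub_zero] at hlim'
  refine tendsto_of_tendsto_of_tendsto_of_le_of_le hlim' tendsto_const_nhds (fun i => ?_)
    fun i => ?_
  · have h : ((𝓕.F i).card * d : ℝ) ≤ t i +
      (∑ m ∈ M, (((𝓕.F i : Set G) \ ((· * m) '' (𝓕.F i : Set G))).ncard : ℝ)) * d := by
      exact_mod_cast h2 i
    dsimp only
    rw [← Finset.sum_div, ← div_eq_mul_inv, le_div_iff₀ (hpos i), sub_mul, mul_right_comm,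
      div_mul_cancel₀ _ (hpos i).ne']
    linarith
  · have h : (t i : ℝ) ≤ (𝓕.F i).card * d := by exact_mod_cast h1 i
    dsimp only
    rw [← div_eq_mul_inv, div_le_iff₀ (hpos i)]
    linarith

theorem dimE_natCast (n : ℕ) : dimE n = ((n : ℝ) : EReal) := by
  change (((n : ℕ∞) : ℝ≥0∞) : EReal) = _
  rw [ENat.toENNReal_coe, ← ENNReal.coe_natCast, EReal.coe_nnreal_eq_coe_real, NNReal.coe_natCast]

theorem mdim_of_isEmpty (K : Type) [Field K] (V : Over (SpecK K)) [IsEmpty V.left] {G : Type}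
    [Group G] (𝓕 : FolnerNet G) (Γ : Set (G → Pt K V)) : mdim K V 𝓕 Γ = ⊥ := by
  have hPt : IsEmpty (Pt K V) := ⟨fun a => isEmptyElim (ev K a)⟩
  have h (i) : cfgDim K V ↥(𝓕.F i) (restr K V Γ (𝓕.F i)) = ⊥ := by
    obtain ⟨g, hg⟩ := 𝓕.nonempty i
    have : IsEmpty (restr K V Γ (𝓕.F i)) := ⟨fun u => isEmptyElim (u.1 ⟨g, hg⟩)⟩
    let := cfgTop K V ↥(𝓕.F i)
    exact topologicalKrullDim_of_isEmpty _
  have hpos (i) : (0 : ℝ) < ((𝓕.F i).card : ℝ)⁻¹ :=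
    inv_pos.mpr (by exact_mod_cast (𝓕.nonempty i).card_pos)
  unfold mdim
  simp_rw [h]
  change limsup (fun i => (⊥ : EReal) * _) _ = _
  simp_rw [EReal.bot_mul_coe_of_pos (hpos _)]
  exact limsup_const _

/-- Proposition 6.6. Let `G` be an amenable group with a Følner net
`𝓕`, `X` an algebraic variety over an algebraically closed field `K`, `A := X(K)`, and
`τ` an algebraic cellular automaton over `(G,X,K)`. If `τ` is `(**)`-pre-injective, then
`mdim_𝓕(τ(A^G)) = dim X`. -/
theorem mdim_eq_of_starStarPreInjective
    (G : Type) [Group G] (𝓕 : FolnerNet G)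
    (K : Type) [Field K] [IsAlgClosed K]
    (V : Over (SpecK K)) (hft : LocallyOfFiniteType V.hom) (hqc : QuasiCompact V.hom)
    (τ : (G → Pt K V) → (G → Pt K V)) (hca : IsAlgCA K V τ)
    (hss : StarStarPreInjective K V τ) :
    mdim K V 𝓕 (Set.range τ) = dimE (vdim K V) := by
  classical
  rcases isEmpty_or_nonempty V.left with hV | hV
  · rw [mdim_of_isEmpty, vdim, topologicalKrullDim_of_isEmpty]
    rfl
  obtain ⟨x, d, hx, hd⟩ := exists_forall_ptdeg_le hft hqc hft (𝟙 V)
  change ptdeg x = d at hx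
  change ∀ y : V.left, ptdeg y ≤ d at hd
  rw [vdim_eq hft hd x hx.ge, dimE_natCast]
  obtain ⟨M, f, hτ⟩ := hca
  change IsDefinedBy τ f at hτ
  choose t ht using exists_isImageDim hft hqc f
  have key := tendsto_div_card 𝓕 M (t := fun i => t (𝓕.F i)) (fun i => (ht _).le_card_mul hd)
    fun i => (hss.card_mul_le hτ hft hqc x hx.ge (𝓕.F i) (ht _)).trans <|
      ((ht _).le_add (ht _) hd Finset.subset_union_left).trans <| by
        gcongr
        exact card_conbhd_sdiff_le M (𝓕.F i)
  have key' := (continuous_coe_real_ereal.tendsto _).comp key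
  have heq : mdim K V 𝓕 (Set.range τ) = limsup (fun i =>
      (((t (𝓕.F i) : ℝ) * ((𝓕.F i).card : ℝ)⁻¹ : ℝ) : EReal)) atTop := by
    unfold mdim
    simp_rw [hτ.cfgDim_restr_range hft hqc (ht _), dimE_natCast, EReal.coe_mul]
  rw [heq]
  exact key'.limsup_eq

end GOE
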